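/- Given complete deterministic finite automata A_1, …, A_n over a common alphabet Σ and a fresh letter λ ∉ Σ, one can construct deterministic finite automata A_1', …, A_n' over Σ ∪ {λ} such that: A_1' has exactly one accepting state and that accepting state is deadlock (has no outgoing transitions); each A_i' (2 ≤ i ≤ n) is deadlock-free and has all states accepting; and for every word w ∈ Σ*, w is accepted by all of A_1, …, A_n if and only if wλ is accepted by all of A_1', …, A_n'. Concretely, A_1' is obtained from A_1 by adding a fresh state ⋄_1, adding a transition q →^{λ} ⋄_1 at each accepting state q, making all former accepting states non-accepting, and making ⋄_1 the unique accepting state; for 2 ≤ i ≤ n, A_i' is obtained from A_i by adding a fresh state ⋄_i, adding a transition q →^{λ} ⋄_i at each accepting state q, adding a self-loop on ⋄_i labeled λ, and making every state (including ⋄_i) accepting. -/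

import Mathlib

namespace DES

/-- Run of a labelled transition system along a finite word of events. -/
inductive RunRel {S : Type*} {E : Type*} (δ : S → E → S → Prop) : S → List E → S → Prop
  | nil (x : S) : RunRel δ x [] x
  | cons {x y z : S} {e : E} {w : List E} :
      δ x e y → RunRel δ y w z → RunRel δ x (e :: w) z

/-- A labelling function (with `none` playing the role of the empty label ε)
extended to words by concatenation (ε's disappear). -/
def obsW {T : Type*} {Λ : Type*} (ℓ : T → Option Λ) (w : List T) : List Λ :=
  w.filterMap ℓ

/-- A finite-state automaton (FSA) `S = (X, T, X₀, δ, Σ, ℓ)`: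
states `X`, events `T`, initial states `init`, transition relation `trans`,
labels `Λ`, labelling function `lbl` (with `none` = ε, i.e. unobservable). -/
structure FSA (X : Type*) (T : Type*) (Λ : Type*) where
  init : Set X
  trans : Set (X × T × X)
  lbl : T → Option Λ

namespace FSA

variable {X : Type*} {T : Type*} {Λ : Type*}

def step (A : FSA X T Λ) (x : X) (t : T) (y : X) : Prop := (x, t, y) ∈ A.trans

/-- extension of the transition relation to words. -/
def Run (A : FSA X T Λ) : X → List T → X → Prop := RunRel A.step

/-- `L(S)`: finite event sequences generated from initial states. -/
def Lang (A : FSA X T Λ) : Set (List T) := {w | ∃ x0 ∈ A.init, ∃ x, A.Run x0 w x}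

def InfRun (A : FSA X T Λ) (x : ℕ → X) (s : ℕ → T) : Prop :=
  x 0 ∈ A.init ∧ ∀ n, A.step (x n) (s n) (x (n + 1))

/-- `L^ω(S)`: infinite event sequences generated from initial states. -/
def LangW (A : FSA X T Λ) : Set (ℕ → T) := {s | ∃ x, A.InfRun x s}

/-- current-state estimate `M_O(S, σ)` under the observation map `O`. -/
def est (A : FSA X T Λ) (O : T → Option Λ) (σ : List Λ) : Set X :=
  {x | ∃ x0 ∈ A.init, ∃ w : List T, obsW O w = σ ∧ A.Run x0 w x}

/-- `y` is reachable from `x` (by a nonempty word). -/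
def Reach (A : FSA X T Λ) (x y : X) : Prop := ∃ w : List T, w ≠ [] ∧ A.Run x w y

/-- `y` lies on a transition cycle. -/
def OnCycle (A : FSA X T Λ) (y : X) : Prop := ∃ w : List T, w ≠ [] ∧ A.Run y w y

/-- the normal sub-automaton: all faulty transitions removed. -/
def normal (A : FSA X T Λ) (Tf : Set T) : FSA X T Λ :=
  ⟨A.init, {tr | tr ∈ A.trans ∧ tr.2.1 ∉ Tf}, A.lbl⟩

/-- local automaton: same data, re-labelled by a local observation map. -/
def localAut (A : FSA X T Λ) (O : T → Option Λ) : FSA X T Λ :=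
  ⟨A.init, A.trans, O⟩

end FSA

/-- local observation map of an observer with observable event set `To`:
it sees the global label on events of `To` and nothing otherwise. -/
noncomputable def localObs {T : Type*} {Λ : Type*} (ℓ : T → Option Λ) (To : Set T) :
    T → Option Λ :=
  fun t => @ite _ (t ∈ To) (Classical.propDecidable _) (ℓ t) none

/-- the first `n` events of an infinite event sequence. -/
def pre {T : Type*} (s : ℕ → T) (n : ℕ) : List T := (List.range n).map s

/-- `s ∈ T*T_f`: the word `s` ends with a faulty event. -/
def endsFaulty {T : Type*} (Tf : Set T) (s : List T) : Prop :=
  ∃ (s₁ : List T) (t : T), t ∈ Tf ∧ s = s₁ ++ [t]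

/-- `T_f ∈ s`: the word `s` contains a faulty event. -/
def hasFault {T : Type*} (Tf : Set T) (s : List T) : Prop := ∃ t ∈ s, t ∈ Tf

namespace FSA

variable {X : Type*} {T : Type*} {Λ : Type*} {L : ℕ}

/-- O-co-detectability (Definition CoDet). -/
def CoDetectable (A : FSA X T Λ) (O : Fin L → T → Option Λ) : Prop :=
  ∃ k : ℕ, ∀ s ∈ A.LangW, ∃ i : Fin L, ∀ n : ℕ,
    k ≤ (obsW (O i) (pre s n)).length →
    (A.est (O i) (obsW (O i) (pre s n))).ncard = 1

/-- strong detectability (Definition StrDet). -/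
def StronglyDetectable (A : FSA X T Λ) : Prop :=
  ∃ k : ℕ, ∀ s ∈ A.LangW, ∀ n : ℕ,
    k ≤ (obsW A.lbl (pre s n)).length →
    (A.est A.lbl (obsW A.lbl (pre s n))).ncard = 1

/-- (O, T_f)-co-diagnosability (Definition CoDiag). -/
def CoDiagnosable (A : FSA X T Λ) (O : Fin L → T → Option Λ) (Tf : Set T) : Prop :=
  ∃ k : ℕ, ∀ s s' : List T, s ∈ A.Lang → endsFaulty Tf s → s ++ s' ∈ A.Lang →
    k ≤ s'.length →
    ∃ i : Fin L, ∀ s'' ∈ A.Lang, obsW (O i) s'' = obsW (O i) (s ++ s') → hasFault Tf s''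

/-- T_f-diagnosability (Definition Diag). -/
def Diagnosable (A : FSA X T Λ) (Tf : Set T) : Prop :=
  ∃ k : ℕ, ∀ s s' : List T, s ∈ A.Lang → endsFaulty Tf s → s ++ s' ∈ A.Lang →
    k ≤ s'.length →
    ∀ s'' ∈ A.Lang, obsW A.lbl s'' = obsW A.lbl (s ++ s') → hasFault Tf s''

/-- (O, T_f)-co-predictability (Definition CoPred). -/
def CoPredictable (A : FSA X T Λ) (O : Fin L → T → Option Λ) (Tf : Set T) : Prop :=
  ∃ k : ℕ, ∀ s ∈ A.Lang, endsFaulty Tf s →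
    ∃ s' : List T, s' <+: s ∧ ¬ hasFault Tf s' ∧
      ∃ i : Fin L, ∀ u v : List T, u ++ v ∈ A.Lang → obsW (O i) s' = obsW (O i) u →
        ¬ hasFault Tf u → k ≤ v.length → hasFault Tf v

/-- T_f-predictability (Definition Pred). -/
def Predictable (A : FSA X T Λ) (Tf : Set T) : Prop :=
  ∃ k : ℕ, ∀ s ∈ A.Lang, endsFaulty Tf s →
    ∃ s' : List T, s' <+: s ∧ ¬ hasFault Tf s' ∧
      ∀ u v : List T, u ++ v ∈ A.Lang → obsW A.lbl s' = obsW A.lbl u →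
        ¬ hasFault Tf u → k ≤ v.length → hasFault Tf v

end FSA

section CC

variable {T : Type*} {Λ : Type*} {L : ℕ}

/-- labelling extended to `Option T` (with `none` = ε). -/
def obsE (ℓ : T → Option Λ) : Option T → Option Λ := fun t? => t?.bind ℓ

/-- one optional step: `none` = stay put, `some t` = take a `t`-transition. -/
def stepOpt {X : Type*} (tr : Set (X × T × X)) : X → Option T → X → Prop :=
  fun x t? y =>
    match t? with
    | none => x = y
    | some t => (x, t, y) ∈ tr

/-- validity of a composite event of the concurrent composition,
restricted to the "active" local components `act`. -/
def ccEventOn (ℓs : Fin L → T → Option Λ) (act : Fin L → Prop)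
    (t0 : Option T) (ts : Fin L → Option T) : Prop :=
  ((∀ j, act j → obsE (ℓs j) t0 = none) ∧
   (∀ j, act j → obsE (ℓs j) (ts j) = none) ∧
   ((t0 ≠ none ∧ ∀ j, act j → ts j = none) ∨
    (t0 = none ∧ ∃ j, act j ∧ ts j ≠ none ∧ ∀ j', act j' → j' ≠ j → ts j' = none)))
  ∨
  ((∃ j, act j ∧ obsE (ℓs j) t0 ≠ none) ∧
   (∀ l, act l →
     (obsE (ℓs l) t0 = none → ts l = none) ∧
     (obsE (ℓs l) t0 ≠ none → obsE (ℓs l) (ts l) = obsE (ℓs l) t0)))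

/-- validity of a composite event of the concurrent composition. -/
def ccEvent (ℓs : Fin L → T → Option Λ) (t0 : Option T) (ts : Fin L → Option T) : Prop :=
  ccEventOn ℓs (fun _ => True) t0 ts

/-- transition relation of the concurrent composition `CC_A(A0; A 0, …, A (L-1))`. -/
def ccTrans {X0 : Type*} {Xs : Fin L → Type*}
    (A0 : FSA X0 T Λ) (A : ∀ i, FSA (Xs i) T Λ) :
    (X0 × (∀ i, Xs i)) → (Option T × (Fin L → Option T)) → (X0 × (∀ i, Xs i)) → Prop :=
  fun p e q =>
    ccEvent (fun i => (A i).lbl) e.1 e.2 ∧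
    stepOpt A0.trans p.1 e.1 q.1 ∧
    ∀ i, stepOpt (A i).trans (p.2 i) (e.2 i) (q.2 i)

/-- initial states of the concurrent composition. -/
def ccInit {X0 : Type*} {Xs : Fin L → Type*}
    (A0 : FSA X0 T Λ) (A : ∀ i, FSA (Xs i) T Λ) : Set (X0 × (∀ i, Xs i)) :=
  {p | p.1 ∈ A0.init ∧ ∀ i, p.2 i ∈ (A i).init}

end CC

section Dia

/-- events of the ⋄-variant of the concurrent composition: ε, an event of `T`,
or the fresh event ⋄. -/
inductive DEv (T : Type*) where
  | eps : DEv T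
  | ev : T → DEv T
  | dia : DEv T

variable {X : Type*} {T : Type*} {Λ : Type*} {L : ℕ}

def devOf : Option T → DEv T
  | none => DEv.eps
  | some t => DEv.ev t

def devToOpt : DEv T → Option T
  | DEv.ev t => some t
  | _ => none

/-- transition relation of the variant concurrent composition
`CC_A^⋄(S; S_1, …, S_L)` of an FSA `A` with its local automata given by the
local observation maps `O i`.  A local component equal to `none` is the fresh
state ⋄. -/
def diaTrans (A : FSA X T Λ) (O : Fin L → T → Option Λ) :
    (X × (Fin L → Option X)) → (Option T × (Fin L → DEv T)) →
    (X × (Fin L → Option X)) → Prop :=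
  fun p e q =>
    -- an ordinary transition of the concurrent composition (all components in X)
    ((∃ ts : Fin L → Option T,
        (∀ i, e.2 i = devOf (ts i)) ∧
        ccEvent O e.1 ts ∧
        stepOpt A.trans p.1 e.1 q.1 ∧
        (∀ i, ∃ xi yi, p.2 i = some xi ∧ q.2 i = some yi ∧ stepOpt A.trans xi (ts i) yi)))
    ∨
    -- the extra ⋄-transitions, at states with some component differing from the 0-th
    ((∃ i, p.2 i ≠ some p.1) ∧
     (∀ i, p.2 i ≠ some p.1 → e.2 i = DEv.dia ∧ q.2 i = none) ∧
     (∃ ts : Fin L → Option T,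
        (∀ i, p.2 i = some p.1 → e.2 i = devOf (ts i)) ∧
        ((ccEventOn O (fun i => p.2 i = some p.1) e.1 ts ∧
          stepOpt A.trans p.1 e.1 q.1 ∧
          (∀ i, p.2 i = some p.1 → ∃ yi, q.2 i = some yi ∧ stepOpt A.trans p.1 (ts i) yi))
         ∨
         (e.1 = none ∧ q.1 = p.1 ∧
          (∀ i, p.2 i = some p.1 → ts i = none ∧ q.2 i = some p.1)))))

/-- initial states of the variant concurrent composition. -/
def diaInit (A : FSA X T Λ) : Set (X × (Fin L → Option X)) :=
  {p | p.1 ∈ A.init ∧ ∀ i, ∃ z ∈ A.init, p.2 i = some z}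

end Dia

/-- a (possibly partial) deterministic finite automaton. -/
structure PDFA (Q : Type*) (A : Type*) where
  start : Q
  accept : Set Q
  trans : Set (Q × A × Q)
  deterministic : ∀ q a q' q'', (q, a, q') ∈ trans → (q, a, q'') ∈ trans → q' = q''

namespace PDFA

variable {Q : Type*} {A : Type*}

def step (M : PDFA Q A) (q : Q) (a : A) (q' : Q) : Prop := (q, a, q') ∈ M.trans

def Accepts (M : PDFA Q A) (w : List A) : Prop :=
  ∃ q, RunRel M.step M.start w q ∧ q ∈ M.accept

def Acyclic (M : PDFA Q A) : Prop := ¬ ∃ (q : Q) (w : List A), w ≠ [] ∧ RunRel M.step q w q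

def Complete (M : PDFA Q A) : Prop := ∀ q a, ∃ q', (q, a, q') ∈ M.trans

def Deadlock (M : PDFA Q A) (q : Q) : Prop := ∀ a q', (q, a, q') ∉ M.trans

def DeadlockFree (M : PDFA Q A) : Prop := ∀ q, ∃ a q', (q, a, q') ∈ M.trans

end PDFA

end DES
namespace DES

def extAut {Q Alp : Type*} (M : PDFA Q Alp) (P : Q → Prop) (loop : Prop)
    (acc : Set (Q ⊕ Unit)) : PDFA (Q ⊕ Unit) (Alp ⊕ Unit) where
  start := Sum.inl M.start
  accept := acc
  trans := {t | match t with
    | (Sum.inl q, Sum.inl a, Sum.inl q') => (q, a, q') ∈ M.trans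
    | (Sum.inl q, Sum.inr _, Sum.inr _) => P q
    | (Sum.inr _, Sum.inr _, Sum.inr _) => loop
    | _ => False}
  deterministic := by
    rintro (q | q) (a | a) (q' | q') (q'' | q'') h h' <;> simp_all
    exact M.deterministic _ _ _ _ h h'

theorem extAut_run {Q Alp : Type*} (M : PDFA Q Alp) (P : Q → Prop) (loop : Prop)
    (acc : Set (Q ⊕ Unit)) (w : List Alp) : ∀ (q : Q) (z : Q ⊕ Unit),
    RunRel (extAut M P loop acc).step (Sum.inl q) (w.map Sum.inl ++ [Sum.inr ()]) z ↔
      z = Sum.inr () ∧ ∃ q', RunRel M.step q w q' ∧ P q' := by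
  induction w with
  | nil =>
    intro q z
    constructor
    · intro h
      cases h with
      | cons h1 h2 =>
        cases h2
        rcases z with z | z
        · exact h1.elim
        · exact ⟨rfl, q, RunRel.nil q, h1⟩
    · rintro ⟨rfl, q', h, hP⟩
      cases h
      exact RunRel.cons (y := Sum.inr ()) hP (RunRel.nil _)
  | cons a w ih =>
    intro q z
    constructor
    · intro h
      cases h with
      | @cons _ y _ _ _ h1 h2 =>
        rcases y with y | y
        · obtain ⟨hz, q', hr, hP⟩ := (ih y z).1 h2
          exact ⟨hz, q', RunRel.cons h1 hr, hP⟩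
        · exact h1.elim
    · rintro ⟨hz, q', h, hP⟩
      cases h with
      | @cons _ y _ _ _ h1 h2 =>
        exact RunRel.cons (y := Sum.inl y) h1 ((ih y z).2 ⟨hz, q', h2, hP⟩)

theorem extAut_accepts {Q Alp : Type*} (M : PDFA Q Alp) (P : Q → Prop) (loop : Prop)
    (acc : Set (Q ⊕ Unit)) (hacc : Sum.inr () ∈ acc) (w : List Alp) :
    (extAut M P loop acc).Accepts (w.map Sum.inl ++ [Sum.inr ()]) ↔
      ∃ q, RunRel M.step M.start w q ∧ P q := by
  constructor
  · rintro ⟨z, hr, _⟩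
    exact ((extAut_run M P loop acc w _ z).1 hr).2
  · intro h
    exact ⟨Sum.inr (), (extAut_run M P loop acc w _ _).2 ⟨rfl, h⟩, hacc⟩

end DES

open DES in
/-- Proposition: given complete DFAs `A_1, …, A_n` over a common alphabet and a
fresh letter λ, one can construct DFAs `A_1', …, A_n'` over the extended
alphabet such that `A_1'` has exactly one accepting state which is deadlock,
every other `A_i'` is deadlock-free with all states accepting, and a word `w`
is accepted by all `A_i` iff `wλ` is accepted by all `A_i'`.  (Index `0` plays
the role of `A_1`; the fresh letter λ is `Sum.inr ()`.) -/
theorem complete_dfa_intersection_normalization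
    {n : ℕ} {Alp : Type*} {Q : Fin (n + 1) → Type*}
    [Fintype Alp] [∀ i, Fintype (Q i)]
    (M : ∀ i, PDFA (Q i) Alp) (hcomp : ∀ i, (M i).Complete) :
    ∃ M' : ∀ i, PDFA (Q i ⊕ Unit) (Alp ⊕ Unit),
      (∃ q, (M' 0).accept = {q} ∧ (M' 0).Deadlock q) ∧
      (∀ i, i ≠ 0 → (M' i).DeadlockFree ∧ (M' i).accept = Set.univ) ∧
      (∀ w : List Alp,
        (∀ i, (M i).Accepts w) ↔
        (∀ i, (M' i).Accepts (w.map Sum.inl ++ [Sum.inr ()]))) := by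
  classical
  have hmem : ∀ i : Fin (n + 1), (Sum.inr () : Q i ⊕ Unit) ∈
      (if i = 0 then {Sum.inr ()} else Set.univ : Set (Q i ⊕ Unit)) := by
    intro i
    split_ifs <;> simp
  rcases isEmpty_or_nonempty Alp with hE | ⟨⟨a⟩⟩
  · -- empty alphabet: the only word is the empty one
    refine ⟨fun i => extAut (M i)
      (fun _ => i = 0 → ∀ j, (M j).Accepts []) (i ≠ 0)
      (if i = 0 then {Sum.inr ()} else Set.univ), ⟨Sum.inr (), ?_, ?_⟩, ?_, ?_⟩
    · simp [extAut]
    · rintro (b | b) (q | q) h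
      · exact h
      · exact h
      · exact h
      · exact h rfl
    · intro i hi
      refine ⟨?_, by simp [extAut, hi]⟩
      rintro (q | q)
      · exact ⟨Sum.inr (), Sum.inr (), fun h => absurd h hi⟩
      · exact ⟨Sum.inr (), Sum.inr (), hi⟩
    · intro w
      have hw : w = [] := by
        cases w with
        | nil => rfl
        | cons b _ => exact hE.elim b
      subst hw
      constructor
      · intro h i
        exact (extAut_accepts _ _ _ _ (hmem i) []).2 ⟨_, RunRel.nil _, fun _ => h⟩
      · intro h
        obtain ⟨q, _, hq⟩ := (extAut_accepts _ _ _ _ (hmem 0) []).1 (h 0)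
        exact hq rfl
  · refine ⟨fun i => extAut (M i) (fun q => q ∈ (M i).accept) (i ≠ 0)
      (if i = 0 then {Sum.inr ()} else Set.univ), ⟨Sum.inr (), ?_, ?_⟩, ?_, ?_⟩
    · simp [extAut]
    · rintro (b | b) (q | q) h
      · exact h
      · exact h
      · exact h
      · exact h rfl
    · intro i hi
      refine ⟨?_, by simp [extAut, hi]⟩
      rintro (q | q)
      · obtain ⟨q', h⟩ := hcomp i q a
        exact ⟨Sum.inl a, Sum.inl q', h⟩
      · exact ⟨Sum.inr (), Sum.inr (), hi⟩
    · intro w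
      exact forall_congr' fun i => (extAut_accepts _ _ _ _ (hmem i) w).symm
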